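/- arXiv:2004.02062 — 6 statements merged into one kernel-verified Lean document; each statement's English description precedes it below -/
import Mathlib

section
/- Let A be an m×n complex matrix, b ∈ ℂ^m, and x⋆ ∈ ℂ^n a vector satisfying A x⋆ = b. Let x ∈ ℂ^n, let i be a row index with A^(i) ≠ 0, and define the Kaczmarz update x' = x + ((b^(i) − A^(i) x) / ‖A^(i)‖₂²) · (A^(i))*. Then ‖x' − x⋆‖₂² = ‖x − x⋆‖₂² − ‖x' − x‖₂². -/
open Matrix Finset

/-- For the Kaczmarz update `x' = x + ((b i − A⁽ⁱ⁾x)/‖A⁽ⁱ⁾‖²)(A⁽ⁱ⁾)*` at a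
nonzero row `i`, and any solution `x⋆` of `A x⋆ = b`, the Pythagorean identity
`‖x' − x⋆‖² = ‖x − x⋆‖² − ‖x' − x‖²` holds. -/
theorem kaczmarz_pythagoras {m n : ℕ} (A : Matrix (Fin m) (Fin n) ℂ) (b : Fin m → ℂ)
    (xstar x : Fin n → ℂ) (hsol : A.mulVec xstar = b)
    (i : Fin m) (hrow : A i ≠ 0)
    (x' : Fin n → ℂ)
    (hx' : x' = x + fun j =>
      ((b i - ∑ j', A i j' * x j') / ((∑ j', ‖A i j'‖ ^ 2 : ℝ) : ℂ)) * star (A i j)) :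
    ∑ j, ‖x' j - xstar j‖ ^ 2 = ∑ j, ‖x j - xstar j‖ ^ 2 - ∑ j, ‖x' j - x j‖ ^ 2 := by
  set S : ℝ := ∑ j, ‖A i j‖ ^ 2 with hS
  have hS_ne : (S : ℂ) ≠ 0 := by
    obtain ⟨k, hk⟩ := Function.ne_iff.mp hrow
    have hpos : 0 < S := Finset.sum_pos' (fun j _ => by positivity)
      ⟨k, Finset.mem_univ k, pow_pos (norm_pos_iff.mpr hk) 2⟩
    exact_mod_cast hpos.ne'
  set c : ℂ := (b i - ∑ j, A i j * x j) / (S : ℂ) with hc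
  have hresidual : ∑ j, A i j * (x j - xstar j) = -(c * S) := by
    have hb : b i = ∑ j, A i j * xstar j := by rw [← hsol]; rfl
    rw [hc, div_mul_cancel₀ _ hS_ne, hb]
    simp [mul_sub]
  have hstep (j : Fin n) : x' j = x j + c * star (A i j) := by rw [hx']; rfl
  have hcross : ∑ j, ((x j - xstar j) * star (c * star (A i j))).re = -(‖c‖ ^ 2 * S) := by
    rw [← Complex.re_sum]
    have : ∑ j, (x j - xstar j) * star (c * star (A i j)) = ((-(‖c‖ ^ 2 * S) : ℝ) : ℂ) := by
      calc
        _ = star c * ∑ j, A i j * (x j - xstar j) := by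
          rw [Finset.mul_sum]
          refine Finset.sum_congr rfl fun j _ => ?_
          rw [star_mul, star_star]
          ring
        _ = -(c * star c * S) := by rw [hresidual]; ring
        _ = _ := by
          rw [Complex.star_def, Complex.mul_conj']
          push_cast
          rfl
    rw [this, Complex.ofReal_re]
  have hnorm : ∑ j, ‖x' j - x j‖ ^ 2 = ‖c‖ ^ 2 * S := by
    simp [hstep, hS, mul_pow, Finset.mul_sum]
  have hexpand : ∑ j, ‖x' j - xstar j‖ ^ 2 = ∑ j, ‖x j - xstar j‖ ^ 2 +
      ∑ j, ‖x' j - x j‖ ^ 2 +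
      2 * ∑ j, ((x j - xstar j) * star (c * star (A i j))).re := by
    rw [Finset.mul_sum, ← Finset.sum_add_distrib, ← Finset.sum_add_distrib]
    refine Finset.sum_congr rfl fun j _ => ?_
    have hd : x' j - x j = c * star (A i j) := by rw [hstep]; ring
    have he : x' j - xstar j = (x j - xstar j) + c * star (A i j) := by rw [hstep]; ring
    rw [hd, he, Complex.sq_norm, Complex.sq_norm, Complex.sq_norm, Complex.normSq_add]
    rfl
  rw [hexpand, hcross, hnorm]
  ring
end

section
/- Let A be a nonzero m×n complex matrix all of whose rows are nonzero, b ∈ ℂ^m with the system Ax = b consistent, and x⋆ = A†b the least-Euclidean-norm solution. Let x₀ ∈ ℂ^n lie in the column space of A*, let r₀ = b − A x₀, assume r₀ ≠ 0, and let ℛ₀ = { i : |r₀^(i)| = max_j |r₀^(j)| }. Let i₀ ∈ ℛ₀ attain max_{i∈ℛ₀} |r₀^(i)|²/‖A^(i)‖₂², and set x₁ = x₀ + (r₀^(i₀)/‖A^(i₀)‖₂²)(A^(i₀))*. Then ‖x₁ − x⋆‖₂² ≤ ( 1 − (1/|ℛ₀|) · (1/Σ_{i∈ℛ₀} ‖A^(i)‖₂²)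 · (1/m) · λ_min(A*A) ) · ‖x₀ − x⋆‖₂². -/
open Matrix Finset

/-- Subtracting the orthogonal projection onto the line spanned by `z` decreases the squared norm
by `‖⟪z, e⟫‖ ^ 2 / ‖z‖ ^ 2`. -/
theorem norm_sub_inner_div_smul_sq {𝕜 E : Type*} [RCLike 𝕜] [NormedAddCommGroup E]
    [InnerProductSpace 𝕜 E] {z : E} (hz : z ≠ 0) (e : E) :
    ‖e - (inner 𝕜 z e / ((‖z‖ ^ 2 : ℝ) : 𝕜)) • z‖ ^ 2 =
      ‖e‖ ^ 2 - ‖inner 𝕜 z e‖ ^ 2 / ‖z‖ ^ 2 := by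
  have hz' : ‖z‖ ≠ 0 := norm_ne_zero_iff.mpr hz
  have hre : RCLike.re (inner 𝕜 e ((inner 𝕜 z e / ((‖z‖ ^ 2 : ℝ) : 𝕜)) • z)) =
      ‖inner 𝕜 z e‖ ^ 2 / ‖z‖ ^ 2 := by
    rw [inner_smul_right, div_mul_eq_mul_div, ← inner_conj_symm e z, RCLike.mul_conj,
      ← RCLike.ofReal_pow, ← RCLike.ofReal_div, RCLike.ofReal_re]
  rw [norm_sub_sq (𝕜 := 𝕜), hre, norm_smul, norm_div, RCLike.norm_ofReal,
    abs_of_nonneg (by positivity)]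
  field_simp
  ring

/-- A vector of least norm in its fibre under `T` is orthogonal to the kernel of `T`. -/
theorem mem_orthogonal_ker_of_norm_le {𝕜 E F : Type*} [RCLike 𝕜] [NormedAddCommGroup E]
    [InnerProductSpace 𝕜 E] [AddCommGroup F] [Module 𝕜 F] (T : E →ₗ[𝕜] F) {x : E}
    (hx : ∀ y, T y = T x → ‖x‖ ^ 2 ≤ ‖y‖ ^ 2) : x ∈ (LinearMap.ker T)ᗮ := by
  rw [Submodule.mem_orthogonal]
  intro z hz
  rcases eq_or_ne z 0 with rfl | hz0
  · simp
  have h := hx (x - (inner 𝕜 z x / ((‖z‖ ^ 2 : ℝ) : 𝕜)) • z) (by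
    rw [map_sub, map_smul, LinearMap.mem_ker.mp hz, smul_zero, sub_zero])
  rw [norm_sub_inner_div_smul_sq hz0] at h
  by_contra hne
  have h1 : 0 < ‖inner 𝕜 z x‖ ^ 2 / ‖z‖ ^ 2 := by
    have := norm_pos_iff.mpr hne
    have := norm_pos_iff.mpr hz0
    positivity
  linarith

/-- If `lam` bounds the positive eigenvalues of `T* T` from below, then
`lam * ‖e‖ ^ 2 ≤ ‖T e‖ ^ 2` for every `e` orthogonal to the kernel of `T`. -/
theorem mul_norm_sq_le_norm_map_sq_of_le_eigenvalues {𝕜 E F : Type*} [RCLike 𝕜]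
    [NormedAddCommGroup E] [InnerProductSpace 𝕜 E] [FiniteDimensional 𝕜 E]
    [NormedAddCommGroup F] [InnerProductSpace 𝕜 F] [FiniteDimensional 𝕜 F]
    (T : E →ₗ[𝕜] F) {lam : ℝ}
    (hlam : ∀ μ : ℝ, 0 < μ → (∃ v, v ≠ 0 ∧ T.adjoint (T v) = (μ : 𝕜) • v) → lam ≤ μ)
    {e : E} (he : e ∈ (LinearMap.ker T)ᗮ) : lam * ‖e‖ ^ 2 ≤ ‖T e‖ ^ 2 := by
  have hT : (T.adjoint ∘ₗ T).IsSymmetric := fun x y => by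
    simp [LinearMap.adjoint_inner_left, LinearMap.adjoint_inner_right]
  let v := hT.eigenvectorBasis rfl
  let μ := hT.eigenvalues rfl
  have hv : ∀ i, T.adjoint (T (v i)) = (μ i : 𝕜) • v i := hT.apply_eigenvectorBasis rfl
  have hμ : ∀ i, μ i = ‖T (v i)‖ ^ 2 := fun i => by
    have h1 : inner 𝕜 (v i) (T.adjoint (T (v i))) = ((‖T (v i)‖ ^ 2 : ℝ) : 𝕜) := by
      rw [LinearMap.adjoint_inner_right, inner_self_eq_norm_sq_to_K, RCLike.ofReal_pow]
    rw [hv, inner_smul_right, inner_self_eq_norm_sq_to_K, v.norm_eq_one] at h1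
    simpa using (RCLike.ofReal_inj (K := 𝕜)).mp (by simpa using h1)
  have hTe : ‖T e‖ ^ 2 = ∑ i, μ i * ‖inner 𝕜 (v i) e‖ ^ 2 := by
    rw [← RCLike.ofReal_inj (K := 𝕜), RCLike.ofReal_pow, ← inner_self_eq_norm_sq_to_K,
      ← LinearMap.adjoint_inner_right, ← v.sum_inner_mul_inner, RCLike.ofReal_sum]
    refine Finset.sum_congr rfl fun i _ => ?_
    rw [LinearMap.adjoint_inner_right, ← LinearMap.adjoint_inner_left, hv, inner_smul_left,
      RCLike.conj_ofReal, mul_left_comm, ← inner_conj_symm e (v i), RCLike.conj_mul]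
    push_cast
    rfl
  rw [hTe, ← v.sum_sq_norm_inner_right, Finset.mul_sum]
  refine Finset.sum_le_sum fun i _ => ?_
  rcases (hμ i ▸ sq_nonneg ‖T (v i)‖ : 0 ≤ μ i).eq_or_lt with h0 | h0
  · have hk : T (v i) = 0 :=
      norm_eq_zero.mp (pow_eq_zero_iff two_ne_zero |>.mp ((hμ i).symm.trans h0.symm))
    rw [(LinearMap.ker T).mem_orthogonal e |>.mp he (v i) hk]
    simp
  · have hne : v i ≠ 0 := v.orthonormal.ne_zero i
    exact mul_le_mul_of_nonneg_right (hlam _ h0 ⟨v i, hne, hv i⟩) (sq_nonneg _)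

/-- First-step error estimate of the greedy Kaczmarz method:
`‖x₁ − x⋆‖₂² ≤ (1 − (1/|ℛ₀|)·(1/Σ_{i∈ℛ₀}‖A⁽ⁱ⁾‖₂²)·(1/m)·λ_min(A*A))·‖x₀ − x⋆‖₂²`,
where `x⋆ = A†b` is the least-Euclidean-norm solution of the consistent system `Ax = b`,
`x₀` lies in the column space of `A*`, `r₀ = b − Ax₀ ≠ 0`, `ℛ₀` is the set of indices of
maximal-modulus entries of `r₀`, and `i₀ ∈ ℛ₀` maximizes `|r₀⁽ⁱ⁾|²/‖A⁽ⁱ⁾‖₂²` over `ℛ₀`. -/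
theorem gk_first_step_estimate {m n : ℕ} (A : Matrix (Fin m) (Fin n) ℂ) (hA : A ≠ 0)
    (hrows : ∀ i, A i ≠ 0) (b : Fin m → ℂ)
    (xstar : Fin n → ℂ) (hsol : A.mulVec xstar = b)
    (hmin_norm : ∀ y : Fin n → ℂ, A.mulVec y = b → ∑ j, ‖xstar j‖ ^ 2 ≤ ∑ j, ‖y j‖ ^ 2)
    (lam : ℝ) (hpos : 0 < lam)
    (heig : ∃ v : Fin n → ℂ, v ≠ 0 ∧ (Aᴴ * A).mulVec v = (lam : ℂ) • v)
    (hminEig : ∀ μ : ℝ, 0 < μ →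
      (∃ v : Fin n → ℂ, v ≠ 0 ∧ (Aᴴ * A).mulVec v = (μ : ℂ) • v) → lam ≤ μ)
    (x₀ : Fin n → ℂ) (hx₀ : ∃ y : Fin m → ℂ, x₀ = Aᴴ.mulVec y)
    (r₀ : Fin m → ℂ) (hr₀def : r₀ = b - A.mulVec x₀) (hr₀ : r₀ ≠ 0)
    (R₀ : Finset (Fin m))
    (hR₀ : R₀ = Finset.univ.filter fun i => ‖r₀ i‖ = ⨆ j : Fin m, ‖r₀ j‖)
    (i₀ : Fin m) (hi₀ : i₀ ∈ R₀)
    (hmax : ∀ i ∈ R₀, ‖r₀ i‖ ^ 2 / ∑ j, ‖A i j‖ ^ 2 ≤ ‖r₀ i₀‖ ^ 2 / ∑ j, ‖A i₀ j‖ ^ 2)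
    (x₁ : Fin n → ℂ)
    (hx₁ : x₁ = x₀ + fun j =>
      (r₀ i₀ / ((∑ j', ‖A i₀ j'‖ ^ 2 : ℝ) : ℂ)) * star (A i₀ j)) :
    ∑ j, ‖x₁ j - xstar j‖ ^ 2 ≤
      (1 - (1 / (R₀.card : ℝ)) * (1 / ∑ i ∈ R₀, ∑ j, ‖A i j‖ ^ 2) * (1 / (m : ℝ)) * lam)
        * ∑ j, ‖x₀ j - xstar j‖ ^ 2 := by
  obtain ⟨y, hy⟩ := hx₀
  set T := Matrix.toEuclideanLin A with hTdef
  have hTadj : T.adjoint = Matrix.toEuclideanLin Aᴴ :=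
    (Matrix.toEuclideanLin_conjTranspose_eq_adjoint A).symm
  set e := WithLp.toLp 2 (x₀ - xstar) with hedef
  have he_norm : ∑ j, ‖x₀ j - xstar j‖ ^ 2 = ‖e‖ ^ 2 := by
    simp [EuclideanSpace.norm_sq_eq, hedef]
  have hTe : ∀ i, T e i = - r₀ i := fun i => by
    simp [hTdef, hedef, Matrix.toLpLin_apply, Matrix.mulVec_sub, hsol, hr₀def]
  have hTe_norm : ‖T e‖ ^ 2 = ∑ i, ‖r₀ i‖ ^ 2 := by
    simp [EuclideanSpace.norm_sq_eq, hTe]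
  have he : e ∈ (LinearMap.ker T)ᗮ := by
    rw [hedef, WithLp.toLp_sub]
    refine sub_mem ?_ (mem_orthogonal_ker_of_norm_le T fun z hz => ?_)
    · rw [Submodule.mem_orthogonal]
      intro z hz
      have hxy : WithLp.toLp 2 x₀ = T.adjoint (WithLp.toLp 2 y) := by
        simp [hTadj, hy, Matrix.toLpLin_apply]
      rw [hxy, LinearMap.adjoint_inner_right, LinearMap.mem_ker.mp hz, inner_zero_left]
    · simpa [EuclideanSpace.norm_sq_eq] using
        hmin_norm z.ofLp (by simpa [hTdef, Matrix.toLpLin_apply, hsol] using hz)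
  have hspec : lam * ‖e‖ ^ 2 ≤ ‖T e‖ ^ 2 := by
    refine mul_norm_sq_le_norm_map_sq_of_le_eigenvalues T (fun μ hμ => ?_) he
    rintro ⟨v, hv, hTv⟩
    refine hminEig μ hμ ⟨v.ofLp, by simpa using hv, ?_⟩
    rw [hTadj] at hTv
    simpa [hTdef, Matrix.toLpLin_apply, Matrix.mulVec_mulVec] using congrArg WithLp.ofLp hTv
  set z : EuclideanSpace ℂ (Fin n) := WithLp.toLp 2 (star (A i₀)) with hzdef
  have hz : z ≠ 0 := by simpa [hzdef] using hrows i₀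
  have hz_norm : ∑ j, ‖A i₀ j‖ ^ 2 = ‖z‖ ^ 2 := by
    simp [EuclideanSpace.norm_sq_eq, hzdef]
  have hze : inner ℂ z e = - r₀ i₀ := by
    rw [← hTe, EuclideanSpace.inner_eq_star_dotProduct]
    simp [hzdef, hTdef, Matrix.toLpLin_apply, Matrix.mulVec, dotProduct_comm]
  have hstep : ∑ j, ‖x₁ j - xstar j‖ ^ 2 = ‖e‖ ^ 2 - ‖r₀ i₀‖ ^ 2 / ‖z‖ ^ 2 := by
    have h := norm_sub_inner_div_smul_sq (𝕜 := ℂ) hz e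
    rw [hze, norm_neg] at h
    rw [← h, EuclideanSpace.norm_sq_eq]
    refine Finset.sum_congr rfl fun j _ => ?_
    rw [hx₁, hz_norm]
    congr 2
    simp [hedef, hzdef]
    ring
  have hM : ∀ i, ‖r₀ i‖ ≤ ‖r₀ i₀‖ := fun i => by
    rw [hR₀, Finset.mem_filter] at hi₀
    rw [hi₀.2]
    exact le_ciSup (Set.finite_range fun j => ‖r₀ j‖).bddAbove i
  have hsum : ‖T e‖ ^ 2 ≤ m * ‖r₀ i₀‖ ^ 2 := by
    rw [hTe_norm]
    simpa using Finset.sum_le_card_nsmul univ (fun i => ‖r₀ i‖ ^ 2) (‖r₀ i₀‖ ^ 2)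
      fun i _ => by gcongr; exact hM i
  have hS : ‖z‖ ^ 2 ≤ ∑ i ∈ R₀, ∑ j, ‖A i j‖ ^ 2 := by
    rw [← hz_norm]
    exact Finset.single_le_sum (f := fun i => ∑ j, ‖A i j‖ ^ 2)
      (fun i _ => Finset.sum_nonneg fun j _ => sq_nonneg _) hi₀
  have hzpos : 0 < ‖z‖ ^ 2 := by have := norm_pos_iff.mpr hz; positivity
  have hcard : (1 : ℝ) ≤ R₀.card := by exact_mod_cast Finset.card_pos.mpr ⟨i₀, hi₀⟩
  have hm : (0 : ℝ) < m := by exact_mod_cast i₀.pos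
  rw [hstep, he_norm, sub_mul, one_mul]
  refine sub_le_sub_left ?_ _
  calc 1 / (R₀.card : ℝ) * (1 / ∑ i ∈ R₀, ∑ j, ‖A i j‖ ^ 2) * (1 / (m : ℝ)) * lam * ‖e‖ ^ 2
      = 1 / (R₀.card : ℝ) * (1 / ∑ i ∈ R₀, ∑ j, ‖A i j‖ ^ 2) * (lam * ‖e‖ ^ 2 / m) := by ring
    _ ≤ 1 * (1 / ‖z‖ ^ 2) * ‖r₀ i₀‖ ^ 2 := by
        gcongr
        · exact (div_le_one (by linarith)).mpr hcard
        · exact (div_le_iff₀ hm).mpr (by linarith)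
    _ = ‖r₀ i₀‖ ^ 2 / ‖z‖ ^ 2 := by ring
end

section
/- Let A be a nonzero m×n complex matrix with m ≥ 2 all of whose rows are nonzero, b ∈ ℂ^m with the system Ax = b consistent, and x⋆ = A†b the least-Euclidean-norm solution. Let x_k ∈ ℂ^n lie in the column space of A*, let r_k = b − A x_k, assume r_k ≠ 0 and that r_k has at least one zero entry (as holds for every iterate with k ≥ 1 of the greedy Kaczmarz method, since the residual entry at the previous working row vanishes). Let ℛ_k = { i : |r_k^(i)| = max_j |r_k^(j)| }, let i_k ∈ ℛ_k attain max_{i∈ℛ_k} |r_k^(i)|²/‖A^(i)‖₂², and set x_{k+1} = x_k + (r_k^(i_k)/‖A^(i_k)‖₂²)(A^(i_k))*. Then ‖x_{k+1} − x⋆‖₂² ≤ ( 1 − (1/|ℛ_k|) · (1/Σ_{i∈ℛ_k} ‖A^(i)‖₂²) · (1/(m−1)) · λ_min(A*A) ) · ‖x_k − x⋆‖₂². -/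
open Matrix Finset

/-- Removing from `x` its component along `a` lowers the squared norm by that of the component. -/
theorem norm_sq_sub_inner_div_smul {E : Type*} [NormedAddCommGroup E] [InnerProductSpace ℂ E]
    (a x : E) (ha : a ≠ 0) :
    ‖x - (inner ℂ a x / ((‖a‖ ^ 2 : ℝ) : ℂ)) • a‖ ^ 2 = ‖x‖ ^ 2 - ‖inner ℂ a x‖ ^ 2 / ‖a‖ ^ 2 := by
  have hn : ‖a‖ ≠ 0 := norm_ne_zero_iff.2 ha
  have hre : (inner ℂ a x / ((‖a‖ ^ 2 : ℝ) : ℂ)) * inner ℂ x a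
      = ((‖inner ℂ a x‖ ^ 2 / ‖a‖ ^ 2 : ℝ) : ℂ) := by
    rw [div_mul_eq_mul_div, ← inner_conj_symm x a, Complex.mul_conj']
    push_cast
    rfl
  rw [@norm_sub_sq ℂ, inner_smul_right, hre, norm_smul, norm_div, Complex.norm_real]
  simp only [RCLike.re_eq_complex_re, Complex.ofReal_re, norm_pow, norm_norm]
  field_simp
  ring

/-- On the orthogonal complement of its kernel, `T` satisfies `lam * ‖e‖² ≤ ‖T e‖²` for any `lam`
below all positive eigenvalues of `T* T`. -/
theorem LinearMap.mul_norm_sq_le_norm_apply_sq {E F : Type*}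
    [NormedAddCommGroup E] [InnerProductSpace ℂ E] [FiniteDimensional ℂ E]
    [NormedAddCommGroup F] [InnerProductSpace ℂ F] [FiniteDimensional ℂ F]
    (T : E →ₗ[ℂ] F) (lam : ℝ)
    (hlam : ∀ μ : ℝ, 0 < μ →
      (∃ v : E, v ≠ 0 ∧ T.adjoint (T v) = (μ : ℂ) • v) → lam ≤ μ)
    (e : E) (he : ∀ v, T v = 0 → inner ℂ v e = 0) :
    lam * ‖e‖ ^ 2 ≤ ‖T e‖ ^ 2 := by
  have hS : (T.adjoint ∘ₗ T).IsSymmetric := fun x y => by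
    simp [LinearMap.adjoint_inner_left, LinearMap.adjoint_inner_right]
  set B := hS.eigenvectorBasis rfl
  set ev := hS.eigenvalues rfl
  have hSB : ∀ i, T.adjoint (T (B i)) = (ev i : ℂ) • B i := fun i =>
    hS.apply_eigenvectorBasis rfl i
  have hTe : ‖T e‖ ^ 2 = ∑ i, ev i * ‖inner ℂ (B i) e‖ ^ 2 := by
    have h : ((‖T e‖ ^ 2 : ℝ) : ℂ) = ((∑ i, ev i * ‖inner ℂ (B i) e‖ ^ 2 : ℝ) : ℂ) := by
      have h1 : inner ℂ e (T.adjoint (T e)) = ((‖T e‖ ^ 2 : ℝ) : ℂ) := by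
        rw [LinearMap.adjoint_inner_right, inner_self_eq_norm_sq_to_K]
        push_cast
        rfl
      rw [← h1, ← B.sum_inner_mul_inner]
      push_cast
      refine Finset.sum_congr rfl fun i _ => ?_
      rw [LinearMap.adjoint_inner_right, ← LinearMap.adjoint_inner_left, hSB, inner_smul_left,
        Complex.conj_ofReal, mul_left_comm, ← inner_conj_symm e, Complex.conj_mul']
    exact_mod_cast h
  have hev_eq : ∀ i, ev i = ‖T (B i)‖ ^ 2 := fun i => by
    have h : ((‖T (B i)‖ ^ 2 : ℝ) : ℂ) = (ev i : ℂ) := by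
      have h1 : inner ℂ (B i) (T.adjoint (T (B i))) = ((‖T (B i)‖ ^ 2 : ℝ) : ℂ) := by
        rw [LinearMap.adjoint_inner_right, inner_self_eq_norm_sq_to_K]
        push_cast
        rfl
      rw [← h1, hSB, inner_smul_right, inner_self_eq_norm_sq_to_K, B.norm_eq_one]
      simp
    exact_mod_cast h.symm
  rw [hTe, ← B.sum_sq_norm_inner_right e, Finset.mul_sum]
  refine Finset.sum_le_sum fun i _ => ?_
  by_cases h0 : T (B i) = 0
  · simp [he _ h0]
  · have hpos : 0 < ev i := by
      rw [hev_eq]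
      positivity
    gcongr
    exact hlam _ hpos ⟨B i, B.orthonormal.ne_zero i, hSB i⟩

/-- A vector of least norm in its coset of the kernel of `T` is orthogonal to that kernel. -/
theorem LinearMap.inner_eq_zero_of_norm_sq_le {E F : Type*}
    [NormedAddCommGroup E] [InnerProductSpace ℂ E] [AddCommGroup F] [Module ℂ F]
    (T : E →ₗ[ℂ] F) (x : E) (hx : ∀ y, T y = T x → ‖x‖ ^ 2 ≤ ‖y‖ ^ 2)
    (v : E) (hv : T v = 0) : inner ℂ v x = 0 := by
  by_cases h0 : v = 0
  · simp [h0]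
  have h := hx (x - (inner ℂ v x / ((‖v‖ ^ 2 : ℝ) : ℂ)) • v) (by simp [hv])
  rw [norm_sq_sub_inner_div_smul v x h0] at h
  by_contra hne
  have : 0 < ‖inner ℂ v x‖ ^ 2 / ‖v‖ ^ 2 := by positivity
  linarith

/-- If one of the entries of `r` vanishes, its squared norm is at most `m - 1` times any bound on
the squared moduli of its entries. -/
theorem sum_norm_sq_le_of_apply_eq_zero {m : ℕ} (r : Fin m → ℂ) (M : ℝ)
    (hM : ∀ i, ‖r i‖ ^ 2 ≤ M) (j : Fin m) (hj : r j = 0) :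
    ∑ i, ‖r i‖ ^ 2 ≤ ((m : ℝ) - 1) * M := by
  rw [← Finset.add_sum_erase _ _ (Finset.mem_univ j), hj]
  have h := Finset.sum_le_card_nsmul (Finset.univ.erase j) _ M fun i _ => hM i
  rw [Finset.card_erase_of_mem (Finset.mem_univ j), Finset.card_univ, Fintype.card_fin,
    nsmul_eq_mul, Nat.cast_pred (Fin.pos j)] at h
  simpa using h

/-- Per-step error estimate of the greedy Kaczmarz method for `k ≥ 1`
(the current residual has a vanishing entry):
`‖x_{k+1} − x⋆‖₂² ≤ (1 − (1/|ℛ_k|)·(1/Σ_{i∈ℛ_k}‖A⁽ⁱ⁾‖₂²)·(1/(m−1))·λ_min(A*A))·‖x_k − x⋆‖₂²`. -/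
theorem gk_per_step_estimate {m n : ℕ} (hm : 2 ≤ m)
    (A : Matrix (Fin m) (Fin n) ℂ) (hA : A ≠ 0)
    (hrows : ∀ i, A i ≠ 0) (b : Fin m → ℂ)
    (xstar : Fin n → ℂ) (hsol : A.mulVec xstar = b)
    (hmin_norm : ∀ y : Fin n → ℂ, A.mulVec y = b → ∑ j, ‖xstar j‖ ^ 2 ≤ ∑ j, ‖y j‖ ^ 2)
    (lam : ℝ) (hpos : 0 < lam)
    (heig : ∃ v : Fin n → ℂ, v ≠ 0 ∧ (Aᴴ * A).mulVec v = (lam : ℂ) • v)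
    (hminEig : ∀ μ : ℝ, 0 < μ →
      (∃ v : Fin n → ℂ, v ≠ 0 ∧ (Aᴴ * A).mulVec v = (μ : ℂ) • v) → lam ≤ μ)
    (xk : Fin n → ℂ) (hxk : ∃ y : Fin m → ℂ, xk = Aᴴ.mulVec y)
    (rk : Fin m → ℂ) (hrkdef : rk = b - A.mulVec xk) (hrk : rk ≠ 0)
    (hzero : ∃ j, rk j = 0)
    (Rk : Finset (Fin m))
    (hRk : Rk = Finset.univ.filter fun i => ‖rk i‖ = ⨆ j : Fin m, ‖rk j‖)
    (ik : Fin m) (hik : ik ∈ Rk)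
    (hmax : ∀ i ∈ Rk, ‖rk i‖ ^ 2 / ∑ j, ‖A i j‖ ^ 2 ≤ ‖rk ik‖ ^ 2 / ∑ j, ‖A ik j‖ ^ 2)
    (xk1 : Fin n → ℂ)
    (hxk1 : xk1 = xk + fun j =>
      (rk ik / ((∑ j', ‖A ik j'‖ ^ 2 : ℝ) : ℂ)) * star (A ik j)) :
    ∑ j, ‖xk1 j - xstar j‖ ^ 2 ≤
      (1 - (1 / (Rk.card : ℝ)) * (1 / ∑ i ∈ Rk, ∑ j, ‖A i j‖ ^ 2)
          * (1 / ((m : ℝ) - 1)) * lam)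
        * ∑ j, ‖xk j - xstar j‖ ^ 2 := by
  set T := Matrix.toEuclideanLin A
  have hTapp : ∀ x : Fin n → ℂ, T (WithLp.toLp 2 x) = WithLp.toLp 2 (A.mulVec x) := fun x => rfl
  have hTadj : T.adjoint = Matrix.toEuclideanLin Aᴴ :=
    (Matrix.toEuclideanLin_conjTranspose_eq_adjoint A).symm
  set e : Fin n → ℂ := xk - xstar with he
  have hAe : A.mulVec e = -rk := by
    rw [he, Matrix.mulVec_sub, hsol, hrkdef, neg_sub]
  have horth : ∀ v, T v = 0 → inner ℂ v (WithLp.toLp 2 e) = 0 := by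
    intro v hv
    have hstar : inner ℂ v (WithLp.toLp 2 xstar) = 0 := by
      refine T.inner_eq_zero_of_norm_sq_le _ (fun y hy => ?_) v hv
      rw [EuclideanSpace.norm_sq_eq, EuclideanSpace.norm_sq_eq]
      exact hmin_norm _ ((congrArg (WithLp.ofLp) hy).trans hsol)
    obtain ⟨y, hy⟩ := hxk
    have hk : inner ℂ v (WithLp.toLp 2 xk) = 0 := by
      have : WithLp.toLp 2 xk = T.adjoint (WithLp.toLp 2 y) := by
        rw [hTadj, hy]
        rfl
      rw [this, LinearMap.adjoint_inner_right, hv, inner_zero_left]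
    rw [he, WithLp.toLp_sub, inner_sub_right, hk, hstar, sub_zero]
  have hspec : lam * ∑ j, ‖e j‖ ^ 2 ≤ ∑ i, ‖rk i‖ ^ 2 := by
    have hT_eig : ∀ μ : ℝ, 0 < μ →
        (∃ v, v ≠ 0 ∧ T.adjoint (T v) = (μ : ℂ) • v) → lam ≤ μ := by
      rintro μ hμ ⟨v, hv0, hv⟩
      refine hminEig μ hμ ⟨v.ofLp, fun h => hv0 (by ext j; simp [h]), ?_⟩
      rw [hTadj] at hv
      rw [← Matrix.mulVec_mulVec]
      exact congrArg WithLp.ofLp hv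
    have h := T.mul_norm_sq_le_norm_apply_sq lam hT_eig _ horth
    rw [hTapp, hAe, EuclideanSpace.norm_sq_eq, EuclideanSpace.norm_sq_eq] at h
    simpa using h
  set N : Fin m → ℝ := fun i => ∑ j, ‖A i j‖ ^ 2 with hN
  have hNpos : ∀ i, 0 < N i := fun i => by
    obtain ⟨j, hj⟩ := Function.ne_iff.1 (hrows i)
    exact Finset.sum_pos' (fun _ _ => by positivity)
      ⟨j, Finset.mem_univ j, by have := norm_pos_iff.2 hj; positivity⟩
  have hstep : ∑ j, ‖xk1 j - xstar j‖ ^ 2 = ∑ j, ‖e j‖ ^ 2 - ‖rk ik‖ ^ 2 / N ik := by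
    set a : EuclideanSpace ℂ (Fin n) := WithLp.toLp 2 fun j => star (A ik j) with ha
    have hna : ‖a‖ ^ 2 = N ik := by
      rw [EuclideanSpace.norm_sq_eq]
      simp [ha, hN]
    have ha0 : a ≠ 0 := by
      intro h
      have := hNpos ik
      rw [← hna, h] at this
      simp at this
    have hin : inner ℂ a (WithLp.toLp 2 e) = -rk ik := by
      rw [← Pi.neg_apply, ← hAe]
      simp [ha, PiLp.inner_apply, Matrix.mulVec, dotProduct, mul_comm]
    have h := norm_sq_sub_inner_div_smul a (WithLp.toLp 2 e) ha0
    rw [hin, hna, norm_neg, EuclideanSpace.norm_sq_eq, EuclideanSpace.norm_sq_eq] at h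
    rw [← h]
    refine Finset.sum_congr rfl fun j _ => ?_
    congr 2
    simp only [hxk1, he, ha, hN, Pi.add_apply, Pi.sub_apply, PiLp.sub_apply, PiLp.smul_apply,
      smul_eq_mul]
    ring
  have hle : ∀ i, ‖rk i‖ ^ 2 ≤ ‖rk ik‖ ^ 2 := fun i => by
    have hik' : ‖rk ik‖ = ⨆ j : Fin m, ‖rk j‖ := by
      rw [hRk] at hik
      exact (Finset.mem_filter.1 hik).2
    rw [hik']
    gcongr
    exact le_ciSup (f := fun j => ‖rk j‖) (Set.finite_range _).bddAbove i
  obtain ⟨j₀, hj₀⟩ := hzero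
  have hres := sum_norm_sq_le_of_apply_eq_zero rk _ hle j₀ hj₀
  have hm1 : (0 : ℝ) < (m : ℝ) - 1 := by
    have : (2 : ℝ) ≤ m := by exact_mod_cast hm
    linarith
  have hNle : N ik ≤ ∑ i ∈ Rk, N i :=
    Finset.single_le_sum (fun i _ => (hNpos i).le) hik
  have hcard : (1 : ℝ) / (Rk.card : ℝ) ≤ 1 := by
    have : (1 : ℝ) ≤ Rk.card := by exact_mod_cast Finset.card_pos.2 ⟨ik, hik⟩
    exact div_le_one_of_le₀ this (by positivity)
  have hbound : (1 / (Rk.card : ℝ)) * (1 / ∑ i ∈ Rk, N i) * (1 / ((m : ℝ) - 1)) * lam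
      * ∑ j, ‖e j‖ ^ 2 ≤ ‖rk ik‖ ^ 2 / N ik := by
    have hpos_ik := hNpos ik
    calc (1 / (Rk.card : ℝ)) * (1 / ∑ i ∈ Rk, N i) * (1 / ((m : ℝ) - 1)) * lam
          * ∑ j, ‖e j‖ ^ 2
        = (1 / (Rk.card : ℝ)) * (1 / ∑ i ∈ Rk, N i) * (1 / ((m : ℝ) - 1))
          * (lam * ∑ j, ‖e j‖ ^ 2) := by ring
      _ ≤ 1 * (1 / N ik) * (1 / ((m : ℝ) - 1)) * (((m : ℝ) - 1) * ‖rk ik‖ ^ 2) := by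
          refine mul_le_mul ?_ (hspec.trans hres) (by positivity) (by positivity)
          gcongr
      _ = ‖rk ik‖ ^ 2 / N ik := by field_simp
  rw [hstep, sub_mul, one_mul]
  exact sub_le_sub_left hbound _
end

section
/- Let A be a nonzero m×n complex matrix with m ≥ 2 all of whose rows are nonzero, b ∈ ℂ^m with Ax = b consistent, and x⋆ = A†b. Let (x_k)_{k≥0} be the greedy Kaczmarz iterates: x₀ lies in the column space of A*, and for each k with r_k = b − A x_k ≠ 0, ℛ_k = { i : |r_k^(i)| = max_j |r_k^(j)| }, i_k ∈ ℛ_k attains max_{i∈ℛ_k} |r_k^(i)|²/‖A^(i)‖₂², and x_{k+1} = x_k + (r_k^(i_k)/‖A^(i_k)‖₂²)(A^(i_k))* (with x_{k+1} = x_k if r_k = 0). Suppose α ≥ 1 and β > 0 satisfy |ℛ_k| ≤ α and Σ_{i∈ℛ_k} ‖A^(i)‖₂² ≤ β for all k. Then for every k ≥ 1, ‖x_k − x⋆‖₂² ≤ ( 1 − λ_min(A*A)/(α·β·(m−1)) )^{k−1} · ( 1 − λ_min(A*A)/(|ℛ₀|·Σ_{i∈ℛ₀}‖A^(i)‖₂²·m)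 ) · ‖x₀ − x⋆‖₂². -/
open Matrix Finset

open scoped ComplexOrder in
/-- The smallest positive eigenvalue of `Aᴴ * A` bounds `‖A e‖² / ‖e‖²` from below for `e`
orthogonal to the kernel of `A`. -/
theorem smallest_pos_eigenvalue_mul_sum_sq_le {m n : ℕ} (A : Matrix (Fin m) (Fin n) ℂ) (lam : ℝ)
    (hminEig : ∀ μ : ℝ, 0 < μ →
      (∃ v : Fin n → ℂ, v ≠ 0 ∧ (Aᴴ * A).mulVec v = (μ : ℂ) • v) → lam ≤ μ)
    (e : Fin n → ℂ) (he : ∀ v : Fin n → ℂ, A *ᵥ v = 0 → star v ⬝ᵥ e = 0) :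
    lam * ∑ j, ‖e j‖ ^ 2 ≤ ∑ i, ‖(A *ᵥ e) i‖ ^ 2 := by
  have hH : (Aᴴ * A).IsHermitian := isHermitian_conjTranspose_mul_self A
  have hps : (Aᴴ * A).PosSemidef := posSemidef_conjTranspose_mul_self A
  set u : Fin n → Fin n → ℂ := fun i => (hH.eigenvectorBasis i).ofLp with hu
  have hev : ∀ i, (Aᴴ * A) *ᵥ u i = ((hH.eigenvalues i : ℝ) : ℂ) • u i := fun i => by
    have := hH.mulVec_eigenvectorBasis i
    ext j
    simpa [hu] using congrFun this j
  have hinner : ∀ i (w : Fin n → ℂ),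
      inner ℂ (hH.eigenvectorBasis i) (WithLp.toLp 2 w) = star (u i) ⬝ᵥ w := fun i w => by
    simp [EuclideanSpace.inner_eq_star_dotProduct, dotProduct_comm, hu]
  have hN : ∑ j, ‖e j‖ ^ 2 = ∑ i, ‖star (u i) ⬝ᵥ e‖ ^ 2 := by
    have := hH.eigenvectorBasis.sum_sq_norm_inner_right (WithLp.toLp 2 e)
    simp only [hinner] at this
    rw [this, EuclideanSpace.norm_sq_eq]
  have hadj : ∀ v w : Fin n → ℂ,
      star v ⬝ᵥ ((Aᴴ * A) *ᵥ w) = star (A *ᵥ v) ⬝ᵥ (A *ᵥ w) := fun v w => by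
    rw [← mulVec_mulVec, dotProduct_mulVec, star_mulVec]
  have hsa : ∀ i, star (u i) ⬝ᵥ ((Aᴴ * A) *ᵥ e)
      = ((hH.eigenvalues i : ℝ) : ℂ) * (star (u i) ⬝ᵥ e) := fun i => by
    have : star (u i) ⬝ᵥ ((Aᴴ * A) *ᵥ e) = star ((Aᴴ * A) *ᵥ u i) ⬝ᵥ e := by
      rw [dotProduct_mulVec, star_mulVec, hH.eq]
    rw [this, hev, star_smul, smul_dotProduct]
    simp
  have hAe : ∑ i, ‖(A *ᵥ e) i‖ ^ 2 = ∑ i, hH.eigenvalues i * ‖star (u i) ⬝ᵥ e‖ ^ 2 := by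
    have h1 := hH.eigenvectorBasis.sum_inner_mul_inner (WithLp.toLp 2 e)
      (WithLp.toLp 2 ((Aᴴ * A) *ᵥ e))
    have h2 : ∀ i, inner ℂ (WithLp.toLp 2 e) (hH.eigenvectorBasis i)
        = star (star (u i) ⬝ᵥ e) := fun i => by
      rw [← hinner, ← inner_conj_symm]; rfl
    simp only [hinner, hsa, h2] at h1
    have h3 : inner ℂ (WithLp.toLp 2 e) (WithLp.toLp 2 ((Aᴴ * A) *ᵥ e))
        = star (A *ᵥ e) ⬝ᵥ (A *ᵥ e) := by
      rw [← hadj, EuclideanSpace.inner_eq_star_dotProduct, dotProduct_comm]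
    rw [h3] at h1
    have h4 : star (A *ᵥ e) ⬝ᵥ (A *ᵥ e) = ((∑ i, ‖(A *ᵥ e) i‖ ^ 2 : ℝ) : ℂ) := by
      simp [dotProduct, Complex.conj_mul']
    rw [h4] at h1
    have h5 : ∀ i, star (star (u i) ⬝ᵥ e) * (((hH.eigenvalues i : ℝ) : ℂ) * (star (u i) ⬝ᵥ e))
        = ((hH.eigenvalues i * ‖star (u i) ⬝ᵥ e‖ ^ 2 : ℝ) : ℂ) := fun i => by
      rw [mul_left_comm]
      have := Complex.conj_mul' (star (u i) ⬝ᵥ e)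
      push_cast
      rw [← this]; rfl
    simp only [h5] at h1
    exact_mod_cast h1.symm
  rw [hN, hAe, mul_sum]
  refine sum_le_sum fun i _ => ?_
  rcases (hps.eigenvalues_nonneg i).eq_or_lt with h0 | h0
  · have hz : A *ᵥ u i = 0 := by
      have := hadj (u i) (u i)
      rw [hev, ← h0] at this
      simp only [Complex.ofReal_zero, zero_smul, dotProduct_zero] at this
      exact dotProduct_star_self_eq_zero.1 this.symm
    rw [he _ hz]; simp
  · refine mul_le_mul_of_nonneg_right (hminEig _ h0 ⟨u i, fun h => ?_, hev i⟩) (by positivity)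
    exact hH.eigenvectorBasis.orthonormal.ne_zero i (by ext j; exact congrFun h j)

theorem sum_sq_pos_of_ne_zero {n : ℕ} {a : Fin n → ℂ} (ha : a ≠ 0) : 0 < ∑ j, ‖a j‖ ^ 2 := by
  obtain ⟨j, hj⟩ := Function.ne_iff.1 ha
  have : 0 < ‖a j‖ := norm_pos_iff.2 hj
  exact sum_pos' (fun _ _ => by positivity) ⟨j, mem_univ _, by positivity⟩

/-- Pythagoras for the projection of `e` onto the hyperplane `a ⬝ᵥ e = 0`. -/
theorem sum_sq_sub_projection {n : ℕ} {a : Fin n → ℂ} (ha : a ≠ 0) (e : Fin n → ℂ) :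
    ∑ j, ‖e j + (-(a ⬝ᵥ e) / ((∑ j', ‖a j'‖ ^ 2 : ℝ) : ℂ)) * star (a j)‖ ^ 2
      = ∑ j, ‖e j‖ ^ 2 - ‖a ⬝ᵥ e‖ ^ 2 / ∑ j, ‖a j‖ ^ 2 := by
  have hs := sum_sq_pos_of_ne_zero ha
  set s := ∑ j, ‖a j‖ ^ 2 with hsdef
  set c := a ⬝ᵥ e with hc
  have hs' : (s : ℂ) ≠ 0 := by exact_mod_cast hs.ne'
  have hcs : c * star c = ((‖c‖ ^ 2 : ℝ) : ℂ) := by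
    push_cast; exact Complex.mul_conj' c
  have hdd : ∑ j, a j * star (a j) = (s : ℂ) := by
    rw [hsdef]; push_cast; exact sum_congr rfl fun j _ => Complex.mul_conj' (a j)
  have key : ∑ j, (e j + (-c / s) * star (a j)) * star (e j + (-c / s) * star (a j))
      = ∑ j, e j * star (e j) - c * star c / s := by
    have h1 : ∀ j, (e j + (-c / s) * star (a j)) * star (e j + (-c / s) * star (a j))
        = e j * star (e j) + (-star c / s) * (a j * e j)
          + (-c / s) * star (a j * e j) + (c * star c / s ^ 2) * (a j * star (a j)) := fun j => by
      have : star (s : ℂ) = s := Complex.conj_ofReal s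
      simp only [star_add, star_mul', star_div₀, star_neg, star_star, this]
      ring
    simp only [h1, sum_add_distrib, ← mul_sum, hdd, ← star_sum]
    have : ∑ j, a j * e j = c := rfl
    rw [this]
    field_simp
    ring
  have h2 : ∀ w : Fin n → ℂ, ∑ j, w j * star (w j) = ((∑ j, ‖w j‖ ^ 2 : ℝ) : ℂ) := fun w => by
    push_cast; exact sum_congr rfl fun j _ => Complex.mul_conj' (w j)
  rw [h2 e, h2 (fun j => e j + (-c / s) * star (a j)), hcs] at key
  exact_mod_cast key

/-- A least-norm solution is orthogonal to the kernel. -/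
theorem star_dotProduct_eq_zero_of_least_norm {m n : ℕ} {A : Matrix (Fin m) (Fin n) ℂ}
    {b : Fin m → ℂ} {z : Fin n → ℂ} (hz : A *ᵥ z = b)
    (hmin : ∀ y : Fin n → ℂ, A *ᵥ y = b → ∑ j, ‖z j‖ ^ 2 ≤ ∑ j, ‖y j‖ ^ 2)
    {v : Fin n → ℂ} (hv : A *ᵥ v = 0) : star v ⬝ᵥ z = 0 := by
  by_cases h0 : v = 0
  · simp [h0]
  have hv0 : star v ≠ 0 := by simpa using h0
  have h := hmin (z + (-(star v ⬝ᵥ z) / ((∑ j', ‖star v j'‖ ^ 2 : ℝ) : ℂ)) • v) (by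
    rw [mulVec_add, mulVec_smul, hv, hz]; simp)
  have h2 := sum_sq_sub_projection hv0 z
  simp only [Pi.star_apply, star_star] at h2
  simp only [Pi.add_apply, Pi.smul_apply, smul_eq_mul, Pi.star_apply] at h
  rw [h2] at h
  have hs := sum_sq_pos_of_ne_zero hv0
  simp only [Pi.star_apply] at hs
  by_contra hne
  have : 0 < ‖star v ⬝ᵥ z‖ := norm_pos_iff.2 hne
  have : 0 < ‖star v ⬝ᵥ z‖ ^ 2 / ∑ j, ‖star (v j)‖ ^ 2 := by positivity
  linarith

/-- An eigenvalue of `Aᴴ * A` is at most the squared Frobenius norm of `A`. -/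
theorem eigenvalue_le_sum_sq {m n : ℕ} (A : Matrix (Fin m) (Fin n) ℂ) {lam : ℝ}
    (heig : ∃ v : Fin n → ℂ, v ≠ 0 ∧ (Aᴴ * A).mulVec v = (lam : ℂ) • v) :
    lam ≤ ∑ i, ∑ j, ‖A i j‖ ^ 2 := by
  obtain ⟨v, hv, h⟩ := heig
  have hs := sum_sq_pos_of_ne_zero hv
  have h1 : lam * ∑ j, ‖v j‖ ^ 2 = ∑ i, ‖(A *ᵥ v) i‖ ^ 2 := by
    have h2 : star v ⬝ᵥ ((Aᴴ * A) *ᵥ v) = star (A *ᵥ v) ⬝ᵥ (A *ᵥ v) := by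
      rw [← mulVec_mulVec, dotProduct_mulVec, star_mulVec]
    have h4 : ∀ {p : ℕ} (w : Fin p → ℂ), star w ⬝ᵥ w = ((∑ i, ‖w i‖ ^ 2 : ℝ) : ℂ) := fun w => by
      simp [dotProduct, Complex.conj_mul']
    rw [h, dotProduct_smul, h4, h4, smul_eq_mul] at h2
    exact_mod_cast h2
  have h3 : ∑ i, ‖(A *ᵥ v) i‖ ^ 2 ≤ ∑ i, (∑ j, ‖A i j‖ ^ 2) * ∑ j, ‖v j‖ ^ 2 := by
    refine sum_le_sum fun i _ => ?_
    have : ‖(A *ᵥ v) i‖ ≤ ∑ j, ‖A i j‖ * ‖v j‖ :=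
      (norm_sum_le univ fun j => A i j * v j).trans_eq (sum_congr rfl fun j _ => norm_mul _ _)
    exact (pow_le_pow_left₀ (norm_nonneg _) this 2).trans (sum_mul_sq_le_sq_mul_sq _ _ _)
  rw [← sum_mul, ← h1] at h3
  exact le_of_mul_le_mul_right h3 hs

/-- Accumulated error estimate of the greedy Kaczmarz method: with
`|ℛ_k| ≤ α` and `Σ_{i∈ℛ_k}‖A⁽ⁱ⁾‖₂² ≤ β` for all `k`, for every `k ≥ 1`,
`‖x_k − x⋆‖₂² ≤ (1 − λ_min(A*A)/(αβ(m−1)))^{k−1}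
  · (1 − λ_min(A*A)/(|ℛ₀|·Σ_{i∈ℛ₀}‖A⁽ⁱ⁾‖₂²·m)) · ‖x₀ − x⋆‖₂²`. -/
theorem gk_accumulated_estimate {m n : ℕ} (hm : 2 ≤ m)
    (A : Matrix (Fin m) (Fin n) ℂ) (hA : A ≠ 0)
    (hrows : ∀ i, A i ≠ 0) (b : Fin m → ℂ)
    (xstar : Fin n → ℂ) (hsol : A.mulVec xstar = b)
    (hmin_norm : ∀ y : Fin n → ℂ, A.mulVec y = b → ∑ j, ‖xstar j‖ ^ 2 ≤ ∑ j, ‖y j‖ ^ 2)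
    (lam : ℝ) (hpos : 0 < lam)
    (heig : ∃ v : Fin n → ℂ, v ≠ 0 ∧ (Aᴴ * A).mulVec v = (lam : ℂ) • v)
    (hminEig : ∀ μ : ℝ, 0 < μ →
      (∃ v : Fin n → ℂ, v ≠ 0 ∧ (Aᴴ * A).mulVec v = (μ : ℂ) • v) → lam ≤ μ)
    (x : ℕ → Fin n → ℂ) (hx₀ : ∃ y : Fin m → ℂ, x 0 = Aᴴ.mulVec y)
    (r : ℕ → Fin m → ℂ) (hr : ∀ k, r k = b - A.mulVec (x k))
    (R : ℕ → Finset (Fin m))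
    (hR : ∀ k, R k = Finset.univ.filter fun i => ‖r k i‖ = ⨆ j : Fin m, ‖r k j‖)
    (idx : ℕ → Fin m)
    (hstep : ∀ k, r k ≠ 0 →
      idx k ∈ R k ∧
      (∀ i ∈ R k, ‖r k i‖ ^ 2 / ∑ j, ‖A i j‖ ^ 2
        ≤ ‖r k (idx k)‖ ^ 2 / ∑ j, ‖A (idx k) j‖ ^ 2) ∧
      x (k + 1) = x k + fun j =>
        (r k (idx k) / ((∑ j', ‖A (idx k) j'‖ ^ 2 : ℝ) : ℂ)) * star (A (idx k) j))
    (hstall : ∀ k, r k = 0 → x (k + 1) = x k)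
    (α β : ℝ) (hα : 1 ≤ α) (hβ : 0 < β)
    (hcard : ∀ k, ((R k).card : ℝ) ≤ α)
    (hsum : ∀ k, ∑ i ∈ R k, ∑ j, ‖A i j‖ ^ 2 ≤ β) :
    ∀ k : ℕ, 1 ≤ k →
      ∑ j, ‖x k j - xstar j‖ ^ 2 ≤
        (1 - lam / (α * β * ((m : ℝ) - 1))) ^ (k - 1)
          * (1 - lam / (((R 0).card : ℝ) * (∑ i ∈ R 0, ∑ j, ‖A i j‖ ^ 2) * (m : ℝ)))
          * ∑ j, ‖x 0 j - xstar j‖ ^ 2 := by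
  set e : ℕ → Fin n → ℂ := fun k j => x k j - xstar j with he
  set E : ℕ → ℝ := fun k => ∑ j, ‖e k j‖ ^ 2 with hE
  set s : Fin m → ℝ := fun i => ∑ j, ‖A i j‖ ^ 2 with hs
  have hs0 : ∀ i, 0 < s i := fun i => sum_sq_pos_of_ne_zero (hrows i)
  have hE0 : ∀ k, 0 ≤ E k := fun k => sum_nonneg fun _ _ => by positivity
  have hm' : (2 : ℝ) ≤ m := by exact_mod_cast hm
  have hre : ∀ k, r k = -(A *ᵥ e k) := fun k => by
    have : e k = x k - xstar := rfl
    rw [hr, this, mulVec_sub, hsol]; abel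
  have hri : ∀ k i, r k i = -(A i ⬝ᵥ e k) := fun k i => congrFun (hre k) i
  have hestep : ∀ k, r k ≠ 0 → ∀ j, e (k + 1) j
      = e k j + (-(A (idx k) ⬝ᵥ e k) / ((s (idx k) : ℝ) : ℂ)) * star (A (idx k) j) :=
    fun k hk j => by
      simp only [he, (hstep k hk).2.2, Pi.add_apply]
      rw [hri]
      ring
  have horth : ∀ k, ∀ v : Fin n → ℂ, A *ᵥ v = 0 → star v ⬝ᵥ e k = 0 := by
    intro k v hv
    induction k with
    | zero =>
      obtain ⟨y, hy⟩ := hx₀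
      have : e 0 = Aᴴ *ᵥ y - xstar := by rw [← hy]; rfl
      rw [this, dotProduct_sub, star_dotProduct_eq_zero_of_least_norm hsol hmin_norm hv,
        dotProduct_mulVec, ← star_mulVec, hv]
      simp
    | succ k ih =>
      by_cases hk : r k = 0
      · have : e (k + 1) = e k := by simp only [he, hstall k hk]
        rw [this, ih]
      · have h1 : e (k + 1) = e k
            + (-(A (idx k) ⬝ᵥ e k) / ((s (idx k) : ℝ) : ℂ)) • star (A (idx k)) := by
          ext j; exact hestep k hk j
        have h2 : A (idx k) ⬝ᵥ v = 0 := congrFun hv (idx k)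
        have h3 : star v ⬝ᵥ star (A (idx k)) = 0 := by
          rw [star_dotProduct_star]
          exact (congrArg star h2).trans (star_zero ℂ)
        rw [h1, dotProduct_add, ih, dotProduct_smul, h3, smul_zero, add_zero]
  have hspec : ∀ k, lam * E k ≤ ∑ i, ‖r k i‖ ^ 2 := fun k => by
    have h := smallest_pos_eigenvalue_mul_sum_sq_le A lam hminEig (e k) (horth k)
    simpa [hre] using h
  have hzero : ∀ k, r k = 0 → E k = 0 := fun k hk => by
    have h := hspec k
    simp only [hk, Pi.zero_apply, norm_zero, ne_eq, OfNat.ofNat_ne_zero, not_false_eq_true,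
      zero_pow, sum_const_zero] at h
    exact le_antisymm (nonpos_of_mul_nonpos_right h hpos) (hE0 k)
  have hEstep : ∀ k, r k ≠ 0 → E (k + 1) = E k - ‖r k (idx k)‖ ^ 2 / s (idx k) :=
    fun k hk => by
      have h := sum_sq_sub_projection (hrows (idx k)) (e k)
      simp only [hE, hestep k hk, hri k (idx k), norm_neg]
      exact h
  have hmax : ∀ k, r k ≠ 0 → ∀ j, ‖r k j‖ ≤ ‖r k (idx k)‖ := fun k hk j => by
    have h := (hstep k hk).1
    rw [hR, mem_filter] at h
    rw [h.2]
    exact le_ciSup (f := fun j => ‖r k j‖) (Set.finite_range _).bddAbove j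
  have hbound : ∀ k, r k ≠ 0 → ∀ D c : ℝ, s (idx k) ≤ D → 0 < c →
      ∑ i, ‖r k i‖ ^ 2 ≤ c * ‖r k (idx k)‖ ^ 2 → E (k + 1) ≤ (1 - lam / (D * c)) * E k := by
    intro k hk D c hD hc hsumr
    have hsi := hs0 (idx k)
    have hDpos : 0 < D := hsi.trans_le hD
    have h1 : lam / (D * c) * E k ≤ ‖r k (idx k)‖ ^ 2 / D := by
      rw [div_mul_eq_mul_div, div_le_div_iff₀ (by positivity) hDpos]
      nlinarith [(hspec k).trans hsumr]
    have h2 : ‖r k (idx k)‖ ^ 2 / D ≤ ‖r k (idx k)‖ ^ 2 / s (idx k) :=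
      div_le_div_of_nonneg_left (by positivity) hsi hD
    rw [hEstep k hk]
    linarith
  have hle : ∀ k, r k ≠ 0 → s (idx k) ≤ ((R k).card : ℝ) * ∑ i ∈ R k, s i := fun k hk => by
    have h1 : s (idx k) ≤ ∑ i ∈ R k, s i :=
      single_le_sum (fun i _ => (hs0 i).le) (hstep k hk).1
    have h2 : (1 : ℝ) ≤ (R k).card := by
      exact_mod_cast card_pos.2 ⟨_, (hstep k hk).1⟩
    nlinarith [hs0 (idx k)]
  have hfirst : E 1 ≤ (1 - lam / (((R 0).card : ℝ) * (∑ i ∈ R 0, s i) * (m : ℝ))) * E 0 := by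
    by_cases h0 : r 0 = 0
    · have h1 : E 1 = E 0 := by simp only [hE, he, hstall 0 h0]
      rw [h1, hzero 0 h0, mul_zero]
    · refine hbound 0 h0 _ _ (hle 0 h0) (by linarith) ?_
      calc ∑ i, ‖r 0 i‖ ^ 2 ≤ ∑ _i : Fin m, ‖r 0 (idx 0)‖ ^ 2 :=
            sum_le_sum fun i _ => pow_le_pow_left₀ (norm_nonneg _) (hmax 0 h0 i) 2
        _ = m * ‖r 0 (idx 0)‖ ^ 2 := by simp
  have hannih : ∀ k, r k ≠ 0 → r (k + 1) (idx k) = 0 := fun k hk => by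
    have h1 : e (k + 1) = e k
        + (-(A (idx k) ⬝ᵥ e k) / ((s (idx k) : ℝ) : ℂ)) • star (A (idx k)) := by
      ext j; exact hestep k hk j
    have h2 : A (idx k) ⬝ᵥ star (A (idx k)) = ((s (idx k) : ℝ) : ℂ) := by
      simp [hs, dotProduct, Complex.mul_conj']
    have h3 : ((s (idx k) : ℝ) : ℂ) ≠ 0 := by exact_mod_cast (hs0 _).ne'
    rw [hri, h1, dotProduct_add, dotProduct_smul, h2, smul_eq_mul, div_mul_cancel₀ _ h3]
    simp
  have hcontract : ∀ k, E (k + 2) ≤ (1 - lam / (α * β * ((m : ℝ) - 1))) * E (k + 1) := by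
    intro k
    by_cases h1 : r (k + 1) = 0
    · have h2 : E (k + 2) = E (k + 1) := by simp only [hE, he, hstall (k + 1) h1]
      rw [h2, hzero _ h1, mul_zero]
    have h0 : r k ≠ 0 := fun h => h1 (by rw [hr, hstall k h, ← hr, h])
    refine hbound (k + 1) h1 _ _ ?_ (by linarith) ?_
    · exact (hle _ h1).trans (mul_le_mul (hcard _) (hsum _)
        (sum_nonneg fun i _ => (hs0 i).le) (by linarith))
    · rw [← add_sum_erase _ _ (mem_univ (idx k)), hannih k h0]
      calc ‖(0 : ℂ)‖ ^ 2 + ∑ i ∈ univ.erase (idx k), ‖r (k + 1) i‖ ^ 2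
          ≤ 0 + ∑ _i ∈ univ.erase (idx k), ‖r (k + 1) (idx (k + 1))‖ ^ 2 := by
            rw [norm_zero]
            exact add_le_add (by simp) (sum_le_sum fun i _ =>
              pow_le_pow_left₀ (norm_nonneg _) (hmax (k + 1) h1 i) 2)
        _ = ((m : ℝ) - 1) * ‖r (k + 1) (idx (k + 1))‖ ^ 2 := by
            rw [sum_const, card_erase_of_mem (mem_univ _), card_univ, Fintype.card_fin,
              nsmul_eq_mul, Nat.cast_sub (by lia)]
            simp
  have hfactor : 0 ≤ 1 - lam / (α * β * ((m : ℝ) - 1)) := by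
    by_cases h1 : r 1 = 0
    · have hR1 : R 1 = univ := by
        rw [hR, h1, filter_eq_self]
        intro i _
        simp
      have h2 : lam ≤ β := (eigenvalue_le_sum_sq A heig).trans (hR1 ▸ hsum 1)
      have h3 : β ≤ α * β := le_mul_of_one_le_left hβ.le hα
      have h4 : α * β ≤ α * β * ((m : ℝ) - 1) :=
        le_mul_of_one_le_right (by positivity) (by linarith)
      rw [sub_nonneg]
      exact div_le_one_of_le₀ (by linarith) (by linarith)
    · have hE1 : 0 < E 1 := by
        refine sum_sq_pos_of_ne_zero fun h => h1 ?_
        rw [hre, h, mulVec_zero, neg_zero]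
      exact nonneg_of_mul_nonneg_left ((hE0 2).trans (hcontract 0)) hE1
  intro k hk
  induction k, hk using Nat.le_induction with
  | base => simpa using hfirst
  | succ k hk ih =>
    obtain ⟨l, rfl⟩ : ∃ l, k = l + 1 := ⟨k - 1, by lia⟩
    refine (hcontract l).trans ((mul_le_mul_of_nonneg_left ih hfactor).trans_eq ?_)
    simp only [Nat.add_sub_cancel]
    ring
end

section
/- Let A be a nonzero m×n complex matrix with m ≥ 2 all of whose rows are nonzero, b ∈ ℂ^m with Ax = b consistent, and x⋆ = A†b. Let (x_k)_{k≥0} be the greedy Kaczmarz iterates: x₀ lies in the column space of A*, and for each k with r_k = b − A x_k ≠ 0, ℛ_k = { i : |r_k^(i)| = max_j |r_k^(j)| }, i_k ∈ ℛ_k attains max_{i∈ℛ_k} |r_k^(i)|²/‖A^(i)‖₂², and x_{k+1} = x_k + (r_k^(i_k)/‖A^(i_k)‖₂²)(A^(i_k))* (with x_{k+1} = x_k if r_k = 0). Then the sequence (x_k) converges to the least-Euclidean-norm solution x⋆ = A†b. -/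
open Matrix Finset

theorem star_dotProduct_self_eq_sum_norm_sq {ι : Type*} [Fintype ι] (w : ι → ℂ) :
    star w ⬝ᵥ w = ((∑ j, ‖w j‖ ^ 2 : ℝ) : ℂ) := by
  simp [dotProduct, Complex.conj_mul']

theorem sum_norm_sq_pos_of_ne_zero {ι : Type*} [Fintype ι] {w : ι → ℂ} (hw : w ≠ 0) :
    0 < ∑ j, ‖w j‖ ^ 2 := by
  obtain ⟨j, hj⟩ := Function.ne_iff.mp hw
  exact Finset.sum_pos' (fun _ _ => by positivity)
    ⟨j, Finset.mem_univ j, pow_pos (norm_pos_iff.mpr hj) 2⟩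

/-- Pythagoras for the orthogonal projection of `e` onto the complement of `u`. -/
theorem sum_norm_sq_sub_projection {ι : Type*} [Fintype ι] {u : ι → ℂ} (hu : u ≠ 0) (e : ι → ℂ) :
    ∑ j, ‖(e - ((star u ⬝ᵥ e) / ((∑ j, ‖u j‖ ^ 2 : ℝ) : ℂ)) • u) j‖ ^ 2
      = ∑ j, ‖e j‖ ^ 2 - ‖star u ⬝ᵥ e‖ ^ 2 / ∑ j, ‖u j‖ ^ 2 := by
  have hN : ((∑ j, ‖u j‖ ^ 2 : ℝ) : ℂ) ≠ 0 :=
    Complex.ofReal_ne_zero.mpr (sum_norm_sq_pos_of_ne_zero hu).ne'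
  have hu_self := star_dotProduct_self_eq_sum_norm_sq u
  have he_self := star_dotProduct_self_eq_sum_norm_sq e
  have hswap : star e ⬝ᵥ u = star (star u ⬝ᵥ e) := by
    rw [← star_dotProduct_star, star_star, dotProduct_comm]
  apply Complex.ofReal_injective
  rw [← star_dotProduct_self_eq_sum_norm_sq, Complex.ofReal_sub, Complex.ofReal_div,
    Complex.ofReal_pow, ← Complex.conj_mul', ← he_self]
  generalize ((∑ j, ‖u j‖ ^ 2 : ℝ) : ℂ) = N at *
  have hN_star : star N = N := by
    rw [← hu_self, ← star_dotProduct_star, star_star, dotProduct_comm]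
  generalize hp : star u ⬝ᵥ e = p at *
  simp only [star_sub, star_smul, sub_dotProduct, dotProduct_sub, smul_dotProduct,
    dotProduct_smul, smul_eq_mul, hu_self, hp, hswap, star_div₀, hN_star, starRingEnd_apply]
  field_simp
  ring

/-- The orthogonal complement of the kernel of `A`. -/
def kerOrthogonal {ι κ : Type*} [Fintype κ] (A : Matrix ι κ ℂ) :
    Submodule ℂ (κ → ℂ) where
  carrier := {v | ∀ z, A *ᵥ z = 0 → star z ⬝ᵥ v = 0}
  add_mem' hv hw z hz := by rw [dotProduct_add, hv z hz, hw z hz, add_zero]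
  zero_mem' z _ := dotProduct_zero _
  smul_mem' c v hv z hz := by rw [dotProduct_smul, hv z hz, smul_zero]

theorem conjTranspose_mulVec_mem_kerOrthogonal {ι κ : Type*} [Fintype ι] [Fintype κ]
    (A : Matrix ι κ ℂ) (y : ι → ℂ) : Aᴴ *ᵥ y ∈ kerOrthogonal A := by
  intro z hz
  rw [dotProduct_mulVec, ← star_mulVec, hz, star_zero, zero_dotProduct]

theorem star_row_mem_kerOrthogonal {ι κ : Type*} [Fintype κ]
    (A : Matrix ι κ ℂ) (i : ι) : star (A i) ∈ kerOrthogonal A := by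
  intro z hz
  rw [star_dotProduct_star]
  exact (congrArg star (congrFun hz i)).trans (star_zero _)

theorem mem_kerOrthogonal_of_forall_le {ι κ : Type*} [Fintype κ]
    {A : Matrix ι κ ℂ} {v : κ → ℂ}
    (hv : ∀ y, A *ᵥ y = A *ᵥ v → ∑ j, ‖v j‖ ^ 2 ≤ ∑ j, ‖y j‖ ^ 2) :
    v ∈ kerOrthogonal A := by
  intro z hz
  by_cases hz0 : z = 0
  · simp [hz0]
  have hle := hv (v - ((star z ⬝ᵥ v) / ((∑ j, ‖z j‖ ^ 2 : ℝ) : ℂ)) • z)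
    (by rw [mulVec_sub, mulVec_smul, hz, smul_zero, sub_zero])
  rw [sum_norm_sq_sub_projection hz0] at hle
  by_contra hne
  have := div_pos (pow_pos (norm_pos_iff.mpr hne) 2) (sum_norm_sq_pos_of_ne_zero hz0)
  linarith

/-- On the orthogonal complement of its kernel, a matrix has a linear left inverse. -/
theorem exists_leftInverse_on_kerOrthogonal {ι κ : Type*} [Fintype κ] (A : Matrix ι κ ℂ) :
    ∃ G : (ι → ℂ) →ₗ[ℂ] (κ → ℂ), ∀ v ∈ kerOrthogonal A, G (A *ᵥ v) = v := by
  have hker : LinearMap.ker (A.mulVecLin ∘ₗ (kerOrthogonal A).subtype) = ⊥ := by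
    rw [LinearMap.ker_eq_bot']
    rintro ⟨v, hv⟩ hAv
    have h0 : star v ⬝ᵥ v = 0 := hv v hAv
    rw [star_dotProduct_self_eq_sum_norm_sq, Complex.ofReal_eq_zero] at h0
    by_contra hne
    exact (sum_norm_sq_pos_of_ne_zero fun h => hne (Subtype.ext h)).ne' h0
  obtain ⟨G, hG⟩ := LinearMap.exists_leftInverse_of_injective _ hker
  exact ⟨(kerOrthogonal A).subtype ∘ₗ G, fun v hv =>
    congrArg Subtype.val (LinearMap.congr_fun hG ⟨v, hv⟩)⟩

/-- The greedy Kaczmarz iterates converge to the least-Euclidean-norm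
solution `x⋆ = A†b` of the consistent system `Ax = b`. -/
theorem gk_converges {m n : ℕ} (hm : 2 ≤ m)
    (A : Matrix (Fin m) (Fin n) ℂ) (hA : A ≠ 0)
    (hrows : ∀ i, A i ≠ 0) (b : Fin m → ℂ)
    (xstar : Fin n → ℂ) (hsol : A.mulVec xstar = b)
    (hmin_norm : ∀ y : Fin n → ℂ, A.mulVec y = b → ∑ j, ‖xstar j‖ ^ 2 ≤ ∑ j, ‖y j‖ ^ 2)
    (x : ℕ → Fin n → ℂ) (hx₀ : ∃ y : Fin m → ℂ, x 0 = Aᴴ.mulVec y)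
    (r : ℕ → Fin m → ℂ) (hr : ∀ k, r k = b - A.mulVec (x k))
    (R : ℕ → Finset (Fin m))
    (hR : ∀ k, R k = Finset.univ.filter fun i => ‖r k i‖ = ⨆ j : Fin m, ‖r k j‖)
    (idx : ℕ → Fin m)
    (hstep : ∀ k, r k ≠ 0 →
      idx k ∈ R k ∧
      (∀ i ∈ R k, ‖r k i‖ ^ 2 / ∑ j, ‖A i j‖ ^ 2
        ≤ ‖r k (idx k)‖ ^ 2 / ∑ j, ‖A (idx k) j‖ ^ 2) ∧
      x (k + 1) = x k + fun j =>
        (r k (idx k) / ((∑ j', ‖A (idx k) j'‖ ^ 2 : ℝ) : ℂ)) * star (A (idx k) j))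
    (hstall : ∀ k, r k = 0 → x (k + 1) = x k) :
    Filter.Tendsto x Filter.atTop (nhds xstar) := by
  have hres : ∀ k, r k = -(A *ᵥ (x k - xstar)) := fun k => by
    rw [hr, mulVec_sub, hsol, neg_sub]
  have hup : ∀ k, r k ≠ 0 → x (k + 1) - xstar = (x k - xstar) -
      ((star (star (A (idx k))) ⬝ᵥ (x k - xstar)) /
        ((∑ j, ‖star (A (idx k)) j‖ ^ 2 : ℝ) : ℂ)) • star (A (idx k)) := by
    intro k hk
    have hrk : A (idx k) ⬝ᵥ (x k - xstar) = -r k (idx k) := by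
      rw [hres, Pi.neg_apply, neg_neg]
      rfl
    rw [(hstep k hk).2.2, star_star, hrk]
    ext j
    simp only [Pi.sub_apply, Pi.add_apply, Pi.smul_apply, Pi.star_apply, norm_star, smul_eq_mul]
    ring
  have hdist : ∀ k, r k ≠ 0 → ∑ j, ‖(x (k + 1) - xstar) j‖ ^ 2 =
      ∑ j, ‖(x k - xstar) j‖ ^ 2 - ‖r k (idx k)‖ ^ 2 / ∑ j, ‖A (idx k) j‖ ^ 2 := by
    intro k hk
    rw [hup k hk, sum_norm_sq_sub_projection (star_ne_zero.mpr (hrows _)), star_star, hres,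
      Pi.neg_apply, norm_neg]
    simp only [Pi.star_apply, norm_star]
    rfl
  have hmem : ∀ k, x k - xstar ∈ kerOrthogonal A := by
    intro k
    induction k with
    | zero =>
      obtain ⟨y, hy⟩ := hx₀
      rw [hy]
      exact sub_mem (conjTranspose_mulVec_mem_kerOrthogonal A y)
        (mem_kerOrthogonal_of_forall_le fun y hy => hmin_norm y (hy.trans hsol))
    | succ k ih =>
      by_cases hk : r k = 0
      · rwa [hstall k hk]
      · rw [hup k hk]
        exact sub_mem ih (Submodule.smul_mem _ _ (star_row_mem_kerOrthogonal A _))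
  set D : ℕ → ℝ := fun k => ∑ j, ‖(x k - xstar) j‖ ^ 2 with hD
  set S : ℝ := ∑ i, ∑ j, ‖A i j‖ ^ 2
  have hrow_le : ∀ i, ∑ j, ‖A i j‖ ^ 2 ≤ S := fun i =>
    Finset.single_le_sum (f := fun i => ∑ j, ‖A i j‖ ^ 2)
      (fun _ _ => by positivity) (Finset.mem_univ i)
  have hbound : ∀ k i, ‖r k i‖ ^ 2 ≤ S * (D k - D (k + 1)) := by
    intro k i
    by_cases hk : r k = 0
    · simp [hD, hstall k hk, hk]
    have hmax : ‖r k i‖ ≤ ‖r k (idx k)‖ := by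
      have hidx := (hstep k hk).1
      rw [hR, Finset.mem_filter] at hidx
      rw [hidx.2]
      exact le_ciSup (f := fun j => ‖r k j‖) (Set.finite_range _).bddAbove i
    have hpos := sum_norm_sq_pos_of_ne_zero (hrows (idx k))
    have hdrop : D k - D (k + 1) = ‖r k (idx k)‖ ^ 2 / ∑ j, ‖A (idx k) j‖ ^ 2 := by
      simp only [hD]
      rw [hdist k hk, sub_sub_cancel]
    calc ‖r k i‖ ^ 2 ≤ ‖r k (idx k)‖ ^ 2 := by gcongr
      _ = (∑ j, ‖A (idx k) j‖ ^ 2) * (D k - D (k + 1)) := by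
        rw [hdrop, mul_div_cancel₀ _ hpos.ne']
      _ ≤ S * (D k - D (k + 1)) := by
        refine mul_le_mul_of_nonneg_right (hrow_le _) ?_
        rw [hdrop]
        positivity
  have hanti : Antitone D := by
    refine antitone_nat_of_succ_le fun k => ?_
    have hSpos : 0 < S := (sum_norm_sq_pos_of_ne_zero (hrows (idx k))).trans_le (hrow_le _)
    exact sub_nonneg.mp (nonneg_of_mul_nonneg_right ((sq_nonneg _).trans (hbound k (idx k))) hSpos)
  have hlim := tendsto_atTop_ciInf hanti ⟨0, by rintro _ ⟨k, rfl⟩; positivity⟩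
  have hdrop_lim : Filter.Tendsto (fun k => S * (D k - D (k + 1))) Filter.atTop (nhds 0) := by
    simpa using (hlim.sub (hlim.comp (Filter.tendsto_add_atTop_nat 1))).const_mul S
  have hr_lim : Filter.Tendsto r Filter.atTop (nhds 0) := by
    refine tendsto_pi_nhds.mpr fun i => tendsto_zero_iff_norm_tendsto_zero.mpr ?_
    have hsq := squeeze_zero (fun k => sq_nonneg ‖r k i‖) (fun k => hbound k i) hdrop_lim
    simpa using hsq.sqrt
  obtain ⟨G, hG⟩ := exists_leftInverse_on_kerOrthogonal A
  have hx : x = fun k => xstar - G (r k) := by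
    ext1 k
    rw [hres, map_neg, hG _ (hmem k)]
    abel
  rw [hx]
  simpa using ((G.continuous_of_finiteDimensional.tendsto 0).comp hr_lim).const_sub xstar
end

section
/- Let A be a nonzero m×n complex matrix with m ≥ 2 all of whose rows are nonzero, and let λ_min(A*A) denote the smallest positive eigenvalue of A*A. Then 1 − λ_min(A*A) / ( ( min_{1≤i≤m} ‖A^(i)‖₂² ) · (m − 1) ) < 1 − (1/2) · ( 1/( ‖A‖_F² − min_{1≤i≤m} ‖A^(i)‖₂² ) + 1/‖A‖_F² ) · λ_min(A*A). That is, the per-step contraction factor of the greedy Kaczmarz method in the case α = 1, β = min_i ‖A^(i)‖₂² is strictly smaller than the expected contraction factor of the greedy randomized Kaczmarz (GRK) method. -/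
open Matrix Finset

/-- For a nonzero matrix `A` with `m ≥ 2` nonzero rows, with `λ_min(A*A)` the
smallest positive eigenvalue of `A*A`, the GK contraction factor in the case
`α = 1`, `β = min_i ‖A⁽ⁱ⁾‖₂²` is strictly smaller than the expected GRK contraction factor:
`1 − λ/((min_i ‖A⁽ⁱ⁾‖₂²)(m−1)) < 1 − (1/2)(1/(‖A‖_F² − min_i ‖A⁽ⁱ⁾‖₂²) + 1/‖A‖_F²)·λ`. -/
theorem gk_factor_lt_grk_factor {m n : ℕ} (hm : 2 ≤ m)
    (A : Matrix (Fin m) (Fin n) ℂ) (hA : A ≠ 0) (hrows : ∀ i, A i ≠ 0)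
    (lam : ℝ) (hpos : 0 < lam)
    (heig : ∃ v : Fin n → ℂ, v ≠ 0 ∧ (Aᴴ * A).mulVec v = (lam : ℂ) • v)
    (hminEig : ∀ μ : ℝ, 0 < μ →
      (∃ v : Fin n → ℂ, v ≠ 0 ∧ (Aᴴ * A).mulVec v = (μ : ℂ) • v) → lam ≤ μ) :
    1 - lam / ((⨅ i : Fin m, ∑ j, ‖A i j‖ ^ 2) * ((m : ℝ) - 1)) <
      1 - (1 / 2) * (1 / ((∑ i, ∑ j, ‖A i j‖ ^ 2) - ⨅ i : Fin m, ∑ j, ‖A i j‖ ^ 2)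
          + 1 / ∑ i, ∑ j, ‖A i j‖ ^ 2) * lam := by
  have hmem : Nonempty (Fin m) := ⟨⟨0, by omega⟩⟩
  have hm' : (2 : ℝ) ≤ m := by exact_mod_cast hm
  set r : Fin m → ℝ := fun i => ∑ j, ‖A i j‖ ^ 2 with hr
  have hr_pos : ∀ i, 0 < r i := by
    intro i
    obtain ⟨j, hj⟩ := Function.ne_iff.mp (hrows i)
    exact Finset.sum_pos' (fun _ _ => by positivity)
      ⟨j, Finset.mem_univ j, pow_pos (norm_pos_iff.mpr hj) 2⟩
  have hb_pos : 0 < ⨅ i, r i := by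
    obtain ⟨i, hi⟩ := exists_eq_ciInf_of_finite (f := r)
    exact hi ▸ hr_pos i
  have hsum : (m : ℝ) * ⨅ i, r i ≤ ∑ i, r i := by
    have h := Finset.card_nsmul_le_sum Finset.univ r (⨅ i, r i)
      (fun i _ => ciInf_le (Set.finite_range r).bddBelow i)
    simpa using h
  change 1 - lam / ((⨅ i, r i) * ((m : ℝ) - 1)) <
    1 - (1 / 2) * (1 / ((∑ i, r i) - ⨅ i, r i) + 1 / ∑ i, r i) * lam
  generalize (⨅ i, r i) = b at *
  generalize (∑ i, r i) = S at *
  have hc : 0 < b * ((m : ℝ) - 1) := mul_pos hb_pos (by linarith)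
  have h₁ : 1 / (S - b) ≤ 1 / (b * ((m : ℝ) - 1)) :=
    one_div_le_one_div_of_le hc (by linarith)
  have h₂ : 1 / S < 1 / (b * ((m : ℝ) - 1)) :=
    one_div_lt_one_div_of_lt hc (by linarith)
  have h₃ : (1 / 2) * (1 / (S - b) + 1 / S) * lam < 1 / (b * ((m : ℝ) - 1)) * lam :=
    mul_lt_mul_of_pos_right (by linarith) hpos
  rw [one_div_mul_eq_div (b * ((m : ℝ) - 1)) lam] at h₃
  linarith
end
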